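/- Fix 0 < q < 1 and an integer n ≥ 1. For 0 < α < q^{-1} and β < q^{-1}, the little q-Jacobi polynomial P_n^{(α,β)}(·;q) has n distinct real zeros x_1(α,β) < ⋯ < x_n(α,β), and for each j ∈ {1,...,n} the zero x_j(α,β) is a strictly decreasing function of α on (0, q^{-1}) and a strictly increasing function of β on (-∞, q^{-1}). -/

import Mathlib

/-- q-Pochhammer symbol `(a;q)_k = ∏_{j=0}^{k-1} (1 - a q^j)`. -/
noncomputable def qpoch (q a : ℝ) (k : ℕ) : ℝ := ∏ j ∈ Finset.range k, (1 - a * q ^ j)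

/-- Little q-Jacobi polynomial `P_n^{(α,β)}(x;q)`. -/
noncomputable def littleQJacobiPoly (q : ℝ) (n : ℕ) (α β x : ℝ) : ℝ :=
  ∑ k ∈ Finset.range (n + 1),
    qpoch q (q ^ (-(n : ℤ))) k * qpoch q (α * β * q ^ (n + 1)) k /
      (qpoch q (α * q) k * qpoch q q k) * (q * x) ^ k

open Polynomial

/-- An everywhere summable weight stays summable against a polynomial sampled on the `q`-grid. -/
lemma summable_mul_eval_pow {q : ℝ} {w : ℕ → ℝ} (h0 : 0 ≤ q) (h1 : q ≤ 1) (hw : Summable w)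
    (p : ℝ[X]) : Summable fun s => w s * p.eval (q ^ s) := by
  obtain ⟨M, hM⟩ := (isCompact_Icc (a := (0 : ℝ)) (b := 1)).exists_bound_of_continuousOn
    p.continuous.continuousOn
  refine Summable.of_norm_bounded (hw.norm.mul_right M) fun s => ?_
  rw [norm_mul]
  exact mul_le_mul_of_nonneg_left (hM _ ⟨pow_nonneg h0 s, pow_le_one₀ h0 h1⟩) (norm_nonneg _)

/-- The functional `p ↦ ∑ₛ w s * p (q ^ s)` on polynomials. -/
noncomputable def gridFunctional {q : ℝ} {w : ℕ → ℝ} (h0 : 0 ≤ q) (h1 : q ≤ 1)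
    (hw : Summable w) : ℝ[X] →ₗ[ℝ] ℝ where
  toFun p := ∑' s, w s * p.eval (q ^ s)
  map_add' p r := by
    simp only [eval_add, mul_add]
    exact (summable_mul_eval_pow h0 h1 hw p).tsum_add (summable_mul_eval_pow h0 h1 hw r)
  map_smul' c p := by
    simp only [eval_smul, smul_eq_mul, RingHom.id_apply, ← tsum_mul_left]
    exact tsum_congr fun s => by ring

lemma gridFunctional_apply {q : ℝ} {w : ℕ → ℝ} (h0 : 0 ≤ q) (h1 : q ≤ 1) (hw : Summable w)
    (p : ℝ[X]) : gridFunctional h0 h1 hw p = ∑' s, w s * p.eval (q ^ s) := rfl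

/-- A nonzero polynomial is nonzero arbitrarily far along the `q`-grid. -/
lemma exists_gt_eval_pow_ne_zero {q : ℝ} (h0 : 0 < q) (h1 : q < 1) {p : ℝ[X]} (hp : p ≠ 0)
    (N : ℕ) : ∃ s > N, p.eval (q ^ s) ≠ 0 := by
  by_contra! h
  refine hp (eq_zero_of_infinite_isRoot p ?_)
  refine ((Set.Ioi_infinite N).image (f := fun s => q ^ s)
    (pow_right_injective₀ h0 h1.ne).injOn).mono ?_
  rintro _ ⟨s, hs, rfl⟩
  exact h s hs

lemma tsum_mul_eval_pow_pos {q : ℝ} {d : ℕ → ℝ} (h0 : 0 < q) (h1 : q < 1) {p : ℝ[X]}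
    (hsum : Summable fun s => d s * p.eval (q ^ s)) (hp : p ≠ 0)
    (hnonneg : ∀ s, 0 ≤ d s * p.eval (q ^ s)) {N : ℕ} (hd : ∀ s > N, d s ≠ 0) :
    0 < ∑' s, d s * p.eval (q ^ s) := by
  obtain ⟨s, hs, hps⟩ := exists_gt_eval_pow_ne_zero h0 h1 hp N
  exact hsum.tsum_pos hnonneg s ((hnonneg s).lt_of_ne' (mul_ne_zero (hd s hs) hps))

/-- `P` is orthogonal to all polynomials of degree less than `n`. -/
def IsOrthogonalTo (L : ℝ[X] →ₗ[ℝ] ℝ) (n : ℕ) (P : ℝ[X]) : Prop :=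
  ∀ g : ℝ[X], g.degree < n → L (P * g) = 0

lemma not_dvd_of_isOrthogonalTo {q : ℝ} {w : ℕ → ℝ} (h0 : 0 < q) (h1 : q < 1)
    (hw : Summable w) (hpos : ∀ s, 0 < w s) {n : ℕ} {P : ℝ[X]} (hP : P ≠ 0)
    (hdeg : P.natDegree = n) (horth : IsOrthogonalTo (gridFunctional h0.le h1.le hw) n P)
    {d : ℝ[X]} (hd : 0 < d.natDegree) (hd_nonneg : ∀ t, 0 ≤ d.eval t) : ¬ d ∣ P := by
  rintro ⟨g, rfl⟩
  have hd0 := left_ne_zero_of_mul hP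
  have hg0 := right_ne_zero_of_mul hP
  rw [natDegree_mul hd0 hg0] at hdeg
  have hz := horth g (by rw [degree_eq_natDegree hg0]; exact_mod_cast (by omega))
  rw [gridFunctional_apply] at hz
  refine (tsum_mul_eval_pow_pos h0 h1 (summable_mul_eval_pow h0.le h1.le hw _)
    (mul_ne_zero hP hg0) (fun s => ?_) (N := 0) fun s _ => (hpos s).ne').ne' hz
  rw [eval_mul, eval_mul, mul_assoc]
  exact mul_nonneg (hpos s).le (mul_nonneg (hd_nonneg _) (mul_self_nonneg _))

/-- An orthogonal polynomial has only real and simple zeros. -/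
lemma exists_eq_C_mul_nodal {q : ℝ} {w : ℕ → ℝ} (h0 : 0 < q) (h1 : q < 1)
    (hw : Summable w) (hpos : ∀ s, 0 < w s) {n : ℕ} {P : ℝ[X]} (hP : P ≠ 0)
    (hdeg : P.natDegree = n) (horth : IsOrthogonalTo (gridFunctional h0.le h1.le hw) n P) :
    ∃ x : Fin n → ℝ, StrictMono x ∧
      P = C P.leadingCoeff * Lagrange.nodal Finset.univ x := by
  have hndvd := fun {d} => not_dvd_of_isOrthogonalTo (d := d) h0 h1 hw hpos hP hdeg horth
  have hsplit : P.Splits := by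
    refine Splits.of_splits_map (algebraMap ℝ ℂ) (IsAlgClosed.splits _) fun z hz => ?_
    rw [mem_roots (by simpa using hP), IsRoot, eval_map_algebraMap] at hz
    by_cases him : z.im = 0
    · exact ⟨z.re, Complex.ext (by simp) (by simp [him])⟩
    · refine absurd (P.quadratic_dvd_of_aeval_eq_zero_im_ne_zero hz him) (hndvd ?_ fun t => ?_)
      · rw [show X ^ 2 - C (2 * z.re) * X + C (‖z‖ ^ 2)
          = C 1 * X ^ 2 + C (-(2 * z.re)) * X + C (‖z‖ ^ 2) by simp; ring,
          natDegree_quadratic one_ne_zero]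
        norm_num
      · simp only [eval_add, eval_sub, eval_mul, eval_pow, eval_X, eval_C]
        rw [← Complex.normSq_eq_norm_sq, Complex.normSq_apply]
        nlinarith [sq_nonneg (t - z.re), mul_self_nonneg z.im]
  have hnodup : P.roots.Nodup := by
    rw [Multiset.nodup_iff_count_le_one]
    intro a
    rw [count_roots]
    by_contra! h
    refine hndvd (d := (X - C a) ^ 2) (by simp) (fun t => ?_) ?_
    · simpa using sq_nonneg (t - a)
    · exact (pow_dvd_pow _ h).trans (pow_rootMultiplicity_dvd P a)
  have hcard : P.roots.toFinset.card = n := by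
    rw [Multiset.toFinset_card_of_nodup hnodup, ← hsplit.natDegree_eq_card_roots, hdeg]
  refine ⟨P.roots.toFinset.orderEmbOfFin hcard, OrderEmbedding.strictMono _, ?_⟩
  conv_lhs => rw [hsplit.eq_prod_roots]
  congr 1
  have hprod := Finset.prod_map Finset.univ (P.roots.toFinset.orderEmbOfFin hcard).toEmbedding
    (fun a => X - C a)
  rwa [Finset.map_orderEmbOfFin_univ, Finset.prod, Multiset.toFinset_val, hnodup.dedup] at hprod

/-- Positivity of the Gauss quadrature at the zeros of an orthogonal polynomial. -/
lemma gridFunctional_nonneg_of_eval_nonneg {q : ℝ} {w : ℕ → ℝ} (h0 : 0 ≤ q) (h1 : q ≤ 1)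
    (hw : Summable w) (hpos : ∀ s, 0 < w s) {n : ℕ} {x : Fin n → ℝ} (hx : StrictMono x)
    (horth : IsOrthogonalTo (gridFunctional h0 h1 hw) n (Lagrange.nodal Finset.univ x))
    {F : ℝ[X]} (hF : F.degree < 2 * n) (hFx : ∀ i, 0 ≤ F.eval (x i)) :
    0 ≤ gridFunctional h0 h1 hw F := by
  have hinj : Set.InjOn x (Finset.univ : Finset (Fin n)) := hx.injective.injOn
  set G : ℝ[X] := ∑ i, F.eval (x i) • Lagrange.basis Finset.univ x i ^ 2 with hG
  have hGeval : ∀ j, G.eval (x j) = F.eval (x j) := by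
    intro j
    rw [hG, eval_finsetSum, Finset.sum_eq_single j]
    · simp [Lagrange.eval_basis_self hinj]
    · intro i _ hij
      simp [Lagrange.eval_basis_of_ne hij]
    · simp
  have hGdeg : G.degree < 2 * n := by
    refine (degree_sum_le _ _).trans_lt ((Finset.sup_lt_iff ?_).2 fun i _ => ?_)
    · exact_mod_cast WithBot.bot_lt_coe (2 * n)
    · refine (degree_smul_le _ _).trans_lt ?_
      rw [degree_pow, Lagrange.degree_basis hinj (Finset.mem_univ i), Finset.card_univ,
        Fintype.card_fin]
      have := i.pos
      rw [nsmul_eq_mul]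
      exact_mod_cast (show 2 * (n - 1) < 2 * n by omega)
  obtain ⟨h, hh⟩ : Lagrange.nodal Finset.univ x ∣ F - G := by
    rw [Lagrange.nodal_eq]
    refine Finset.prod_dvd_of_coprime (fun i _ j _ hij => ?_) fun i _ => ?_
    · exact isCoprime_X_sub_C_of_isUnit_sub (sub_ne_zero.2 (hx.injective.ne hij)).isUnit
    · rw [dvd_iff_isRoot, IsRoot, eval_sub, hGeval, sub_self]
  have hhdeg : h.degree < n := by
    by_cases hz : h = 0
    · rw [hz, degree_zero]; exact WithBot.bot_lt_coe n
    have hlt : (F - G).degree < 2 * n := (degree_sub_le _ _).trans_lt (max_lt hF hGdeg)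
    rw [hh, degree_mul, Lagrange.degree_nodal, Finset.card_univ, Fintype.card_fin,
      degree_eq_natDegree hz] at hlt
    rw [degree_eq_natDegree hz]
    norm_cast at hlt ⊢
    omega
  have hFG : F = Lagrange.nodal Finset.univ x * h + G := by rw [← hh]; ring
  rw [hFG, map_add, horth h hhdeg, zero_add, hG, map_sum]
  refine Finset.sum_nonneg fun i _ => ?_
  rw [map_smul, smul_eq_mul]
  refine mul_nonneg (hFx i) (tsum_nonneg fun s => mul_nonneg (hpos s).le ?_)
  rw [eval_pow]
  exact sq_nonneg _

/-- A strictly decreasing positive sequence can be compared with the decreasing grid `q ^ s`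
around any threshold `t`. -/
lemma exists_level_of_strictAnti {q : ℝ} (h0 : 0 < q) (h1 : q < 1) {g : ℕ → ℝ}
    (hg : StrictAnti g) (hg_pos : ∀ s, 0 < g s) (t : ℝ) :
    ∃ c : ℝ, ∃ N : ℕ, 0 ≤ c ∧ (∀ s, 0 ≤ (g s - c) * (q ^ s - t)) ∧ ∀ s > N, g s - c ≠ 0 := by
  rcases le_or_gt t 0 with ht | ht
  · refine ⟨0, 0, le_rfl, fun s => ?_, fun s _ => by simpa using (hg_pos s).ne'⟩
    have := pow_pos h0 s
    exact mul_nonneg (by linarith [hg_pos s]) (by linarith)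
  · have hex : ∃ s : ℕ, q ^ s ≤ t := (exists_pow_lt_of_lt_one ht h1).imp fun _ => le_of_lt
    classical
    refine ⟨g (Nat.find hex), Nat.find hex, (hg_pos _).le, fun s => ?_,
      fun s hs => (sub_neg.2 (hg hs)).ne⟩
    rcases lt_or_ge s (Nat.find hex) with hs | hs
    · exact mul_nonneg (sub_nonneg.2 (hg hs).le)
        (sub_nonneg.2 (not_le.1 (Nat.find_min hex hs)).le)
    · exact mul_nonneg_of_nonpos_of_nonpos (sub_nonpos.2 (hg.antitone hs))
        (sub_nonpos.2 ((pow_le_pow_of_le_one h0.le h1.le hs).trans (Nat.find_spec hex)))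

/-- **Markov monotonicity theorem** on the `q`-grid: if `v / u` decreases along the grid (that is, increases
in the variable), the zeros for `v` lie strictly to the right of the zeros for `u`. -/
lemma zero_lt_zero_of_strictAnti_ratio {q : ℝ} (h0 : 0 < q) (h1 : q < 1) {u v g : ℕ → ℝ}
    (hu : Summable u) (hv : Summable v) (hu_pos : ∀ s, 0 < u s) (hv_pos : ∀ s, 0 < v s)
    (hg : StrictAnti g) (hg_pos : ∀ s, 0 < g s) (hvu : ∀ s, v s = g s * u s)
    {n : ℕ} {x y : Fin n → ℝ} (hx : StrictMono x) (hy : StrictMono y)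
    (hox : IsOrthogonalTo (gridFunctional h0.le h1.le hu) n (Lagrange.nodal Finset.univ x))
    (hoy : IsOrthogonalTo (gridFunctional h0.le h1.le hv) n (Lagrange.nodal Finset.univ y))
    (j : Fin n) : x j < y j := by
  by_contra! hxy
  set f : ℝ[X] := Lagrange.nodal (Finset.Iio j) x * Lagrange.nodal (Finset.Ioi j) y with hf
  set F : ℝ[X] := (X - C (y j)) * f ^ 2 with hF
  have hf0 : f ≠ 0 := mul_ne_zero Lagrange.nodal_ne_zero Lagrange.nodal_ne_zero
  have hF0 : F ≠ 0 := mul_ne_zero (X_sub_C_ne_zero _) (pow_ne_zero _ hf0)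
  have hFdeg : F.degree < 2 * n := by
    rw [degree_eq_natDegree hF0, hF, natDegree_mul (X_sub_C_ne_zero _) (pow_ne_zero _ hf0),
      natDegree_X_sub_C, natDegree_pow, hf,
      natDegree_mul Lagrange.nodal_ne_zero Lagrange.nodal_ne_zero, Lagrange.natDegree_nodal,
      Lagrange.natDegree_nodal, Fin.card_Iio, Fin.card_Ioi]
    have := j.isLt
    norm_cast
    omega
  have hFeval : ∀ t, F.eval t = (t - y j) * f.eval t ^ 2 := fun t => by simp [hF]
  have hFx : 0 ≤ gridFunctional h0.le h1.le hu F := by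
    refine gridFunctional_nonneg_of_eval_nonneg h0.le h1.le hu hu_pos hx hox hFdeg fun i => ?_
    rw [hFeval]
    rcases lt_or_ge i j with hi | hi
    · simp [hf, Lagrange.eval_nodal_at_node (Finset.mem_Iio.2 hi)]
    · exact mul_nonneg (sub_nonneg.2 (hxy.trans (hx.monotone hi))) (sq_nonneg _)
  have hFy : 0 ≤ gridFunctional h0.le h1.le hv (-F) := by
    refine gridFunctional_nonneg_of_eval_nonneg h0.le h1.le hv hv_pos hy hoy
      (by rwa [degree_neg]) fun i => ?_
    rw [eval_neg, hFeval, neg_nonneg]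
    rcases le_or_gt i j with hi | hi
    · exact mul_nonpos_of_nonpos_of_nonneg (sub_nonpos.2 (hy.monotone hi)) (sq_nonneg _)
    · simp [hf, Lagrange.eval_nodal_at_node (Finset.mem_Ioi.2 hi)]
  obtain ⟨c, N, hc, hnonneg, hne⟩ := exists_level_of_strictAnti h0 h1 hg hg_pos (y j)
  have hsv := summable_mul_eval_pow h0.le h1.le hv F
  have hsu := (summable_mul_eval_pow h0.le h1.le hu F).mul_left c
  have heq : ∀ s, v s * F.eval (q ^ s) - c * (u s * F.eval (q ^ s))
      = (g s - c) * u s * F.eval (q ^ s) := fun s => by rw [hvu]; ring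
  have hpos : 0 < ∑' s, (g s - c) * u s * F.eval (q ^ s) := by
    refine tsum_mul_eval_pow_pos h0 h1 ((hsv.sub hsu).congr heq) hF0 (fun s => ?_)
      (N := N) fun s hs => mul_ne_zero (hne s hs) (hu_pos s).ne'
    rw [hFeval, show (g s - c) * u s * ((q ^ s - y j) * f.eval (q ^ s) ^ 2)
      = ((g s - c) * (q ^ s - y j)) * (u s * f.eval (q ^ s) ^ 2) by ring]
    exact mul_nonneg (hnonneg s) (mul_nonneg (hu_pos s).le (sq_nonneg _))
  rw [← tsum_congr heq, hsv.tsum_sub hsu, tsum_mul_left, ← gridFunctional_apply h0.le h1.le hv,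
    ← gridFunctional_apply h0.le h1.le hu] at hpos
  rw [map_neg] at hFy
  nlinarith [mul_nonneg hc hFx]

/-- If the coefficients `a` and the moments `μ` obey the two-term relations of a common
symmetric lower-triangular operator, then `a` is orthogonal to the low moments. -/
lemma sum_mul_moment_eq_zero {a μ ev c : ℕ → ℝ} {n : ℕ} (hc : c 0 = 0) (ha : a (n + 1) = 0)
    (hsymm : ∀ k m, (ev k - ev m) * μ (k + m) = (c m - c k) * μ (k + m - 1))
    (heig : ∀ k, (ev n - ev k) * a k = c (k + 1) * a (k + 1))
    {m : ℕ} (hm : m < n) (hev : ∀ m < n, ev n ≠ ev m) :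
    ∑ k ∈ Finset.range (n + 1), a k * μ (k + m) = 0 := by
  have hshift : ∀ m, ∑ k ∈ Finset.range (n + 1), c (k + 1) * a (k + 1) * μ (k + m)
      = ∑ k ∈ Finset.range (n + 1), c k * a k * μ (k + m - 1) := by
    intro m
    have hs := Finset.sum_range_succ' (fun k => c k * a k * μ (k + m - 1)) (n + 1)
    rw [Finset.sum_range_succ, ha, hc] at hs
    simp only [mul_zero, zero_mul, add_zero] at hs
    rw [hs]
    refine Finset.sum_congr rfl fun k _ => ?_
    rw [show k + 1 + m - 1 = k + m by omega]
  have hkey : ∀ m, (ev n - ev m) * ∑ k ∈ Finset.range (n + 1), a k * μ (k + m)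
      = c m * ∑ k ∈ Finset.range (n + 1), a k * μ (k + m - 1) := by
    intro m
    have hsplit : (ev n - ev m) * ∑ k ∈ Finset.range (n + 1), a k * μ (k + m)
        = ∑ k ∈ Finset.range (n + 1), c (k + 1) * a (k + 1) * μ (k + m)
          + ∑ k ∈ Finset.range (n + 1), (c m - c k) * a k * μ (k + m - 1) := by
      rw [Finset.mul_sum, ← Finset.sum_add_distrib]
      refine Finset.sum_congr rfl fun k _ => ?_
      linear_combination μ (k + m) * heig k + a k * hsymm k m
    rw [hsplit, hshift, ← Finset.sum_add_distrib, Finset.mul_sum]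
    exact Finset.sum_congr rfl fun k _ => by ring
  induction m with
  | zero =>
    have h := hkey 0
    rw [hc, zero_mul] at h
    exact (mul_eq_zero.1 h).resolve_left (sub_ne_zero.2 (hev 0 hm))
  | succ m ih =>
    have h := hkey (m + 1)
    simp only [← add_assoc, Nat.add_sub_cancel] at h
    rw [ih (by omega), mul_zero] at h
    exact (mul_eq_zero.1 h).resolve_left (sub_ne_zero.2 (hev _ hm))

lemma qpoch_succ (q a : ℝ) (k : ℕ) : qpoch q a (k + 1) = qpoch q a k * (1 - a * q ^ k) :=
  Finset.prod_range_succ _ _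

lemma qpoch_pos {q a : ℝ} (h0 : 0 ≤ q) (h1 : q ≤ 1) (ha : a < 1) (k : ℕ) : 0 < qpoch q a k := by
  refine Finset.prod_pos fun j _ => sub_pos.2 ?_
  have hj0 := pow_nonneg h0 j
  have hj1 : q ^ j ≤ 1 := pow_le_one₀ h0 h1
  rcases le_or_gt a 0 with h | h
  · nlinarith
  · nlinarith

lemma mul_lt_one_of_lt_inv {q a : ℝ} (h0 : 0 < q) (ha : a < q⁻¹) : a * q < 1 := by
  rwa [← lt_div_iff₀ h0, one_div]

/-- The weight of the little `q`-Jacobi polynomials at the grid point `q ^ s`. -/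
noncomputable def littleQJacobiWeight (q α β : ℝ) (s : ℕ) : ℝ :=
  (α * q) ^ s * qpoch q (β * q) s / qpoch q q s

section LittleQJacobi

variable {q α β : ℝ}

lemma littleQJacobiWeight_pos (h0 : 0 < q) (h1 : q < 1) (hα : 0 < α) (hβ : β < q⁻¹) (s : ℕ) :
    0 < littleQJacobiWeight q α β s :=
  div_pos (mul_pos (pow_pos (mul_pos hα h0) s)
    (qpoch_pos h0.le h1.le (mul_lt_one_of_lt_inv h0 hβ) s)) (qpoch_pos h0.le h1.le h1 s)

lemma one_sub_pow_succ_pos (h0 : 0 < q) (h1 : q < 1) (k : ℕ) : 0 < 1 - q ^ (k + 1) :=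
  sub_pos.2 (pow_lt_one₀ h0.le h1 k.succ_ne_zero)

lemma littleQJacobiWeight_succ (h0 : 0 < q) (h1 : q < 1) (s : ℕ) :
    littleQJacobiWeight q α β (s + 1) * (1 - q ^ (s + 1))
      = α * q * (1 - β * q ^ (s + 1)) * littleQJacobiWeight q α β s := by
  have hq := (qpoch_pos h0.le h1.le h1 s).ne'
  have hs := (one_sub_pow_succ_pos h0 h1 s).ne'
  have hs' : 1 - q * q ^ s ≠ 0 := by rwa [← pow_succ']
  rw [littleQJacobiWeight, littleQJacobiWeight, qpoch_succ, qpoch_succ]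
  field_simp
  ring

lemma summable_littleQJacobiWeight (h0 : 0 < q) (h1 : q < 1) (hα : 0 < α) (hα1 : α < q⁻¹)
    (hβ : β < q⁻¹) : Summable (littleQJacobiWeight q α β) := by
  have hpos := littleQJacobiWeight_pos h0 h1 hα hβ
  refine summable_of_ratio_test_tendsto_lt_one (mul_lt_one_of_lt_inv h0 hα1)
    (Filter.Eventually.of_forall fun s => (hpos s).ne') ?_
  have hlim : Filter.Tendsto (fun s : ℕ => q ^ (s + 1)) Filter.atTop (nhds 0) :=
    (tendsto_pow_atTop_nhds_zero_of_lt_one h0.le h1).comp (Filter.tendsto_add_atTop_nat 1)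
  have hratio : Filter.Tendsto
      (fun s : ℕ => α * q * (1 - β * q ^ (s + 1)) / (1 - q ^ (s + 1))) Filter.atTop
      (nhds (α * q * (1 - β * 0) / (1 - 0))) :=
    (((hlim.const_mul β).const_sub 1).const_mul (α * q)).div (hlim.const_sub 1) (by norm_num)
  simp only [mul_zero, sub_zero, mul_one, div_one] at hratio
  refine hratio.congr fun s => ?_
  rw [Real.norm_of_nonneg (hpos _).le, Real.norm_of_nonneg (hpos _).le,
    div_eq_div_iff (one_sub_pow_succ_pos h0 h1 s).ne' (hpos s).ne']
  exact (littleQJacobiWeight_succ h0 h1 s).symm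

lemma gridFunctional_littleQJacobiWeight_X_pow_succ (h0 : 0 < q) (h1 : q < 1)
    (hw : Summable (littleQJacobiWeight q α β)) (m : ℕ) :
    (1 - α * β * q ^ (m + 2)) * gridFunctional h0.le h1.le hw (X ^ (m + 1))
      = (1 - α * q ^ (m + 1)) * gridFunctional h0.le h1.le hw (X ^ m) := by
  set L := gridFunctional h0.le h1.le hw
  set w := littleQJacobiWeight q α β
  have hL : ∀ p : ℝ[X], L p = ∑' s, w s * p.eval (q ^ s) := fun _ => rfl
  have hstep : L (X ^ m - X ^ (m + 1))
      = α * q ^ (m + 1) * L (X ^ m - C (β * q) * X ^ (m + 1)) := by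
    rw [hL, hL, (summable_mul_eval_pow h0.le h1.le hw _).tsum_eq_zero_add, ← tsum_mul_left]
    simp only [eval_sub, eval_mul, eval_pow, eval_X, eval_C, pow_zero, one_pow, sub_self,
      mul_zero, zero_add]
    refine tsum_congr fun s => ?_
    have := littleQJacobiWeight_succ (α := α) (β := β) h0 h1 s
    linear_combination (q ^ (s + 1)) ^ m * this
  rw [← smul_eq_C_mul, map_sub, map_sub, map_smul, smul_eq_mul] at hstep
  linear_combination -hstep

/-- The coefficients of the little `q`-Jacobi polynomial. -/
noncomputable def littleQJacobiCoeff (q : ℝ) (n : ℕ) (α β : ℝ) (k : ℕ) : ℝ :=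
  qpoch q (q ^ (-(n : ℤ))) k * qpoch q (α * β * q ^ (n + 1)) k /
    (qpoch q (α * q) k * qpoch q q k) * q ^ k

/-- The little `q`-Jacobi polynomial as an element of `ℝ[X]`. -/
noncomputable def littleQJacobi (q : ℝ) (n : ℕ) (α β : ℝ) : ℝ[X] :=
  ∑ k ∈ Finset.range (n + 1), C (littleQJacobiCoeff q n α β k) * X ^ k

lemma eval_littleQJacobi (n : ℕ) (x : ℝ) :
    (littleQJacobi q n α β).eval x = littleQJacobiPoly q n α β x := by
  rw [littleQJacobi, littleQJacobiPoly, eval_finsetSum]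
  refine Finset.sum_congr rfl fun k _ => ?_
  simp only [eval_mul, eval_C, eval_pow, eval_X, littleQJacobiCoeff]
  ring

lemma littleQJacobiCoeff_succ (h0 : 0 < q) (h1 : q < 1) (hα1 : α < q⁻¹) {Q : ℝ}
    (hQ : Q * q = 1) (n k : ℕ) :
    littleQJacobiCoeff q n α β (k + 1) * ((1 - α * q ^ (k + 1)) * (1 - q ^ (k + 1)))
      = littleQJacobiCoeff q n α β k *
        ((1 - Q ^ n * q ^ k) * (1 - α * β * q ^ (n + 1) * q ^ k) * q) := by
  obtain rfl := eq_inv_of_mul_eq_one_left hQ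
  have hαq := mul_lt_one_of_lt_inv h0 hα1
  have hne := (qpoch_pos h0.le h1.le h1 (k + 1)).ne'
  have hne' := (qpoch_pos h0.le h1.le hαq (k + 1)).ne'
  rw [qpoch_succ] at hne hne'
  obtain ⟨ha, hb⟩ := mul_ne_zero_iff.1 hne
  obtain ⟨hc, hd⟩ := mul_ne_zero_iff.1 hne'
  simp only [littleQJacobiCoeff, qpoch_succ, zpow_neg, zpow_natCast, inv_pow]
  rw [show α * q ^ (k + 1) = α * q * q ^ k by ring, pow_succ' q k]
  generalize qpoch q (q ^ n)⁻¹ k = A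
  generalize (q ^ n)⁻¹ = B
  generalize 1 - α * q * q ^ k = D at hd ⊢
  generalize 1 - q * q ^ k = E at hb ⊢
  field_simp

lemma mul_mul_pow_lt_one (h0 : 0 < q) (h1 : q < 1) (hα : 0 < α) (hα1 : α < q⁻¹)
    (hβ : β < q⁻¹) (k : ℕ) : α * β * q ^ (k + 2) < 1 := by
  have ha := mul_lt_one_of_lt_inv h0 hα1
  have hb := mul_lt_one_of_lt_inv h0 hβ
  have hab : (α * q) * (β * q) < 1 := by
    have : 0 < α * q := mul_pos hα h0
    nlinarith
  have hk0 := pow_pos h0 k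
  have hk1 : q ^ k ≤ 1 := pow_le_one₀ h0.le h1.le
  rw [show α * β * q ^ (k + 2) = (α * q) * (β * q) * q ^ k by ring]
  nlinarith

lemma littleQJacobiCoeff_self_ne_zero (h0 : 0 < q) (h1 : q < 1) (hα : 0 < α) (hα1 : α < q⁻¹)
    (hβ : β < q⁻¹) {n : ℕ} (hn : 1 ≤ n) : littleQJacobiCoeff q n α β n ≠ 0 := by
  have hαq := mul_lt_one_of_lt_inv h0 hα1
  have hαβ : α * β * q ^ (n + 1) < 1 := by
    obtain ⟨k, rfl⟩ := Nat.exists_eq_add_of_le' hn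
    exact mul_mul_pow_lt_one h0 h1 hα hα1 hβ k
  have hfirst : qpoch q (q ^ (-(n : ℤ))) n ≠ 0 := by
    refine Finset.prod_ne_zero_iff.2 fun j hj => sub_ne_zero.2 fun h => ?_
    rw [zpow_neg, zpow_natCast, inv_mul_eq_div, eq_comm, div_eq_one_iff_eq (pow_pos h0 n).ne'] at h
    exact (Finset.mem_range.1 hj).ne (pow_right_injective₀ h0 h1.ne h)
  refine mul_ne_zero (div_ne_zero (mul_ne_zero hfirst (qpoch_pos h0.le h1.le hαβ n).ne')
    (mul_ne_zero (qpoch_pos h0.le h1.le hαq n).ne' (qpoch_pos h0.le h1.le h1 n).ne'))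
    (pow_pos h0 n).ne'

lemma coeff_littleQJacobi_self (n : ℕ) :
    (littleQJacobi q n α β).coeff n = littleQJacobiCoeff q n α β n := by
  simp [littleQJacobi, coeff_X_pow]

lemma natDegree_littleQJacobi (h0 : 0 < q) (h1 : q < 1) (hα : 0 < α) (hα1 : α < q⁻¹)
    (hβ : β < q⁻¹) {n : ℕ} (hn : 1 ≤ n) : (littleQJacobi q n α β).natDegree = n := by
  refine natDegree_eq_of_le_of_coeff_ne_zero ?_ ?_
  · exact natDegree_sum_le_of_forall_le _ _ fun k hk => (natDegree_C_mul_X_pow_le _ k).trans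
      (Nat.lt_succ_iff.1 (Finset.mem_range.1 hk))
  · rw [coeff_littleQJacobi_self]
    exact littleQJacobiCoeff_self_ne_zero h0 h1 hα hα1 hβ hn

lemma isOrthogonalTo_littleQJacobi (h0 : 0 < q) (h1 : q < 1) (hα : 0 < α) (hα1 : α < q⁻¹)
    (hβ : β < q⁻¹) (hw : Summable (littleQJacobiWeight q α β)) (n : ℕ) :
    IsOrthogonalTo (gridFunctional h0.le h1.le hw) n (littleQJacobi q n α β) := by
  set L := gridFunctional h0.le h1.le hw
  obtain ⟨Q, hQ⟩ : ∃ Q : ℝ, Q * q = 1 := ⟨q⁻¹, inv_mul_cancel₀ h0.ne'⟩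
  have hinv : ∀ k : ℕ, Q ^ k * q ^ k = 1 := fun k => by rw [← mul_pow, hQ, one_pow]
  have hmoment : ∀ m < n, L (littleQJacobi q n α β * X ^ m) = 0 := by
    intro m hm
    have hrec : L (littleQJacobi q n α β * X ^ m) = ∑ k ∈ Finset.range (n + 1),
        littleQJacobiCoeff q n α β k * L (X ^ (k + m)) := by
      rw [littleQJacobi, Finset.sum_mul, map_sum]
      refine Finset.sum_congr rfl fun k _ => ?_
      rw [mul_assoc, ← pow_add, ← smul_eq_C_mul, map_smul, smul_eq_mul]
    rw [hrec]
    refine sum_mul_moment_eq_zero (μ := fun k => L (X ^ k))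
      (ev := fun k => Q ^ k + α * β * q * q ^ k)
      (c := fun k => -(Q ^ k - α - 1 + α * q ^ k)) (by simp) ?_ (fun k m => ?_) (fun k => ?_)
      hm fun m hm => ?_
    · have hz : qpoch q (q ^ (-(n : ℤ))) (n + 1) = 0 := by
        rw [qpoch_succ, zpow_neg, zpow_natCast, inv_mul_cancel₀ (pow_pos h0 n).ne', sub_self,
          mul_zero]
      simp only [littleQJacobiCoeff, hz, zero_mul, zero_div]
    · rcases Nat.eq_zero_or_pos (k + m) with hkm | hkm
      · obtain ⟨rfl, rfl⟩ : k = 0 ∧ m = 0 := by omega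
        simp
      · obtain ⟨N, hN⟩ := Nat.exists_eq_add_of_le' hkm
        have hmu := gridFunctional_littleQJacobiWeight_X_pow_succ h0 h1 hw N
        rw [show α * β * q ^ (N + 2) = α * β * q * (q ^ k * q ^ m) by
          rw [← pow_add, hN]; ring, show α * q ^ (N + 1) = α * (q ^ k * q ^ m) by
          rw [← pow_add, hN]] at hmu
        simp only [hN, Nat.add_sub_cancel]
        linear_combination (Q ^ k - Q ^ m) * hmu
          + (α * β * q * L (X ^ (N + 1)) - α * L (X ^ N)) *
            (q ^ m * hinv k - q ^ k * hinv m)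
    · have hsucc := littleQJacobiCoeff_succ (β := β) h0 h1 hα1 hQ n k
      have hq : Q ^ (k + 1) * q = Q ^ k := by rw [pow_succ, mul_assoc, hQ, mul_one]
      rw [show α * β * q ^ (n + 1) * q ^ k = α * β * q * q ^ n * q ^ k by ring] at hsucc
      generalize littleQJacobiCoeff q n α β (k + 1) = B at hsucc ⊢
      generalize littleQJacobiCoeff q n α β k = A at hsucc ⊢
      linear_combination Q ^ (k + 1) * hsucc
        + B * (1 - α * q ^ (k + 1) + α) * hinv (k + 1)
        + A * (1 - Q ^ n * q ^ k) * (1 - α * β * q * q ^ n * q ^ k) * hq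
        + A * (α * β * q * q ^ k * hinv n - (α * β * q * q ^ n
          + Q ^ n * (1 - α * β * q * q ^ n * q ^ k)) * hinv k)
    · intro h
      have hQ1 : 1 < Q := by
        rw [eq_inv_of_mul_eq_one_left hQ]
        exact (one_lt_inv₀ h0).2 h1
      have hlt : Q ^ m < Q ^ n := pow_lt_pow_right₀ hQ1 hm
      have hfac := mul_mul_pow_lt_one h0 h1 hα hα1 hβ (n + m - 1)
      rw [show n + m - 1 + 2 = n + m + 1 by omega] at hfac
      refine (mul_pos (sub_pos.2 hlt) (sub_pos.2 hfac)).ne' ?_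
      linear_combination h - α * β * q * q ^ m * hinv n + α * β * q * q ^ n * hinv m
  intro g hg
  by_cases hg0 : g = 0
  · rw [hg0, mul_zero, map_zero]
  rw [g.as_sum_range' n ((natDegree_lt_iff_degree_lt hg0).2 hg), Finset.mul_sum, map_sum]
  refine Finset.sum_eq_zero fun m hm => ?_
  rw [← C_mul_X_pow_eq_monomial, mul_left_comm, ← smul_eq_C_mul, map_smul,
    hmoment m (Finset.mem_range.1 hm), smul_zero]

end LittleQJacobi

lemma exists_zeros_littleQJacobi {q α β : ℝ} (h0 : 0 < q) (h1 : q < 1) (hα : 0 < α)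
    (hα1 : α < q⁻¹) (hβ : β < q⁻¹) {n : ℕ} (hn : 1 ≤ n) :
    ∃ x : Fin n → ℝ, StrictMono x ∧ (∀ y, littleQJacobiPoly q n α β y = 0 ↔ ∃ j, y = x j) ∧
      ∀ hw : Summable (littleQJacobiWeight q α β),
        IsOrthogonalTo (gridFunctional h0.le h1.le hw) n (Lagrange.nodal Finset.univ x) := by
  have hw := summable_littleQJacobiWeight h0 h1 hα hα1 hβ
  have hdeg := natDegree_littleQJacobi h0 h1 hα hα1 hβ hn
  have hP : littleQJacobi q n α β ≠ 0 := by
    rintro h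
    rw [h, natDegree_zero] at hdeg
    omega
  have hlead := leadingCoeff_ne_zero.2 hP
  have horth := isOrthogonalTo_littleQJacobi h0 h1 hα hα1 hβ hw n
  obtain ⟨x, hx, hPx⟩ := exists_eq_C_mul_nodal h0 h1 hw
    (littleQJacobiWeight_pos h0 h1 hα hβ) hP hdeg horth
  refine ⟨x, hx, fun y => ?_, fun _ g hg => ?_⟩
  · rw [← eval_littleQJacobi, hPx, eval_mul, eval_C, Lagrange.eval_nodal, mul_eq_zero,
      or_iff_right hlead, Finset.prod_eq_zero_iff]
    simp [sub_eq_zero]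
  · have h := horth g hg
    rw [hPx, mul_assoc, ← smul_eq_C_mul, map_smul, smul_eq_mul] at h
    exact (mul_eq_zero.1 h).resolve_left hlead

/-- The ratio of two weights with different `β` decreases along the grid. -/
lemma strictAnti_qpoch_div {q β₁ β₂ : ℝ} (h0 : 0 < q) (h1 : q < 1) (hβ : β₁ < β₂)
    (hβ₂ : β₂ < q⁻¹) : StrictAnti fun s => qpoch q (β₂ * q) s / qpoch q (β₁ * q) s := by
  refine strictAnti_nat_of_succ_lt fun s => ?_
  have hlt₁ := mul_lt_one_of_lt_inv h0 (hβ.trans hβ₂)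
  have hpos₁ := qpoch_pos h0.le h1.le hlt₁ s
  have hpos₂ := qpoch_pos h0.le h1.le (mul_lt_one_of_lt_inv h0 hβ₂) s
  have hpos₁' := qpoch_pos h0.le h1.le hlt₁ (s + 1)
  rw [div_lt_div_iff₀ hpos₁' hpos₁, qpoch_succ, qpoch_succ]
  have hqs : 0 < q * q ^ s := mul_pos h0 (pow_pos h0 s)
  have : 0 < qpoch q (β₂ * q) s * qpoch q (β₁ * q) s * ((β₂ - β₁) * (q * q ^ s)) :=
    mul_pos (mul_pos hpos₂ hpos₁) (mul_pos (sub_pos.2 hβ) hqs)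
  linarith

/-- zeros of little q-Jacobi polynomials: monotonicity in `α` and `β`. -/
theorem stmt_15 (q : ℝ) (hq0 : 0 < q) (hq1 : q < 1) (n : ℕ) (hn : 1 ≤ n) :
    ∃ x : ℝ → ℝ → Fin n → ℝ,
      (∀ α β : ℝ, 0 < α → α < q⁻¹ → β < q⁻¹ →
        StrictMono (x α β) ∧
        (∀ j, littleQJacobiPoly q n α β (x α β j) = 0) ∧
        (∀ y : ℝ, littleQJacobiPoly q n α β y = 0 → ∃ j, y = x α β j)) ∧
      (∀ β : ℝ, β < q⁻¹ →
        ∀ j, StrictAntiOn (fun α => x α β j) (Set.Ioo 0 q⁻¹)) ∧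
      (∀ α : ℝ, 0 < α → α < q⁻¹ →
        ∀ j, StrictMonoOn (fun β => x α β j) (Set.Iio q⁻¹)) := by
  have hexists := fun α β (h : 0 < α ∧ α < q⁻¹ ∧ β < q⁻¹) =>
    exists_zeros_littleQJacobi hq0 hq1 h.1 h.2.1 h.2.2 hn
  choose! x hmono hzero horth using hexists
  have hsum := fun α β (h : 0 < α ∧ α < q⁻¹ ∧ β < q⁻¹) =>
    summable_littleQJacobiWeight hq0 hq1 h.1 h.2.1 h.2.2
  have hpos := fun α β (h : 0 < α ∧ α < q⁻¹ ∧ β < q⁻¹) =>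
    littleQJacobiWeight_pos hq0 hq1 h.1 h.2.2
  have hcompare : ∀ α₁ β₁ α₂ β₂, (h₁ : 0 < α₁ ∧ α₁ < q⁻¹ ∧ β₁ < q⁻¹) →
      (h₂ : 0 < α₂ ∧ α₂ < q⁻¹ ∧ β₂ < q⁻¹) → ∀ g : ℕ → ℝ, StrictAnti g → (∀ s, 0 < g s) →
      (∀ s, littleQJacobiWeight q α₂ β₂ s = g s * littleQJacobiWeight q α₁ β₁ s) →
      ∀ j, x α₁ β₁ j < x α₂ β₂ j := fun α₁ β₁ α₂ β₂ h₁ h₂ g hg hg_pos hratio =>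
    zero_lt_zero_of_strictAnti_ratio hq0 hq1 (hsum _ _ h₁) (hsum _ _ h₂) (hpos _ _ h₁)
      (hpos _ _ h₂) hg hg_pos hratio (hmono _ _ h₁) (hmono _ _ h₂) (horth _ _ h₁ _)
      (horth _ _ h₂ _)
  refine ⟨x, fun α β hα hα1 hβ => ?_, fun β hβ j α₁ hα₁ α₂ hα₂ hlt => ?_,
    fun α hα hα1 j β₁ hβ₁ β₂ hβ₂ hlt => ?_⟩
  · have h := And.intro hα (And.intro hα1 hβ)
    exact ⟨hmono _ _ h, fun j => (hzero _ _ h _).2 ⟨j, rfl⟩, fun y => (hzero _ _ h y).1⟩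
  · refine hcompare _ _ _ _ ⟨hα₂.1, hα₂.2, hβ⟩ ⟨hα₁.1, hα₁.2, hβ⟩ (fun s => (α₁ / α₂) ^ s)
      (pow_right_strictAnti₀ (div_pos hα₁.1 hα₂.1) ((div_lt_one hα₂.1).2 hlt))
      (fun s => pow_pos (div_pos hα₁.1 hα₂.1) s) (fun s => ?_) j
    have := hα₂.1.ne'
    simp only [littleQJacobiWeight]
    rw [mul_div_assoc, mul_div_assoc, ← mul_assoc, ← mul_pow,
      show α₁ / α₂ * (α₂ * q) = α₁ * q by field_simp]
  · have hpoch := fun s => qpoch_pos hq0.le hq1.le (mul_lt_one_of_lt_inv hq0 hβ₁) s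
    refine hcompare _ _ _ _ ⟨hα, hα1, hβ₁⟩ ⟨hα, hα1, hβ₂⟩ _
      (strictAnti_qpoch_div hq0 hq1 hlt hβ₂)
      (fun s => div_pos (qpoch_pos hq0.le hq1.le (mul_lt_one_of_lt_inv hq0 hβ₂) s) (hpoch s))
      (fun s => ?_) j
    have hne := (hpoch s).ne'
    simp only [littleQJacobiWeight]
    generalize qpoch q (β₁ * q) s = z at hne ⊢
    field_simp
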